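/- Let J ⊆ I and let v, w ∈ W with v ≤^J w and ℓ^J(w) − ℓ^J(v) = 2. Then the interval {z ∈ W : v ≤^J z ≤^J w} of (W, ≤^J) has exactly 4 elements; that is, (W, ≤^J) is thin. -/

import Mathlib

/-!
Common definitions: Bruhat order, standard parabolic subgroups, minimal coset
representatives, the J-Bruhat (twisted) order and J-length, chains and
EL-labeling machinery, for a Coxeter system `cs : CoxeterSystem M W`.
-/

open scoped Classical

namespace TwistedTP

/-- A chain (list) realizing consecutive `r`-steps starting at `a` and ending at `b`. -/
def IsChainFrom {α : Type*} (r : α → α → Prop) (c : List α) (a b : α) : Prop :=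
  c.head? = some a ∧ c.getLast? = some b ∧ c.Chain' r

/-- The word of labels attached to the consecutive pairs of a list.
For a list `z₀ :: z₁ :: ⋯` (written from top to bottom in a descending chain),
the entries are `lab z₁ z₀, lab z₂ z₁, …`, i.e. `lab` is applied to each
covering pair `(lower, upper)`. -/
def labelWord {α Λ : Type*} (lab : α → α → Λ) : List α → List Λ
  | a :: b :: rest => lab b a :: labelWord lab (b :: rest)
  | _ => []

variable {B : Type*} {W : Type*} [Group W] {M : CoxeterMatrix B}
variable (cs : CoxeterSystem M W)

/-- The (strong) Bruhat order on `W`: `v ≤ w` iff some reduced word for `w`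
has a sublist whose product is `v`. -/
def bruhatLE (v w : W) : Prop :=
  ∃ ω : List B, cs.IsReduced ω ∧ cs.wordProd ω = w ∧
    ∃ ω' : List B, ω'.Sublist ω ∧ cs.wordProd ω' = v

def bruhatLT (v w : W) : Prop := bruhatLE cs v w ∧ v ≠ w

def bruhatCovBy (v w : W) : Prop :=
  bruhatLT cs v w ∧ ¬ ∃ z, bruhatLT cs v z ∧ bruhatLT cs z w

/-- The standard parabolic subgroup `W_J`. -/
def parabolic (J : Set B) : Subgroup W := Subgroup.closure (cs.simple '' J)

lemma exists_minRep (J : Set B) (w : W) :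
    ∃ u : W, u⁻¹ * w ∈ parabolic cs J ∧
      ∀ x : W, x⁻¹ * w ∈ parabolic cs J → cs.length u ≤ cs.length x := by
  have hne : (cs.length '' {x : W | x⁻¹ * w ∈ parabolic cs J}).Nonempty :=
    ⟨cs.length w, w, by simpa using (parabolic cs J).one_mem, rfl⟩
  obtain ⟨n, hn, hmin⟩ := Nat.lt_wfRel.wf.has_min _ hne
  obtain ⟨u, hu, rfl⟩ := hn
  refine ⟨u, hu, fun x hx => ?_⟩
  by_contra h
  exact hmin _ ⟨x, hx, rfl⟩ (Nat.lt_of_not_le h)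

/-- The minimal-length representative `w^J` of the coset `w W_J`. -/
noncomputable def minRep (J : Set B) (w : W) : W := (exists_minRep cs J w).choose

/-- The parabolic part `w_J = (w^J)⁻¹ w ∈ W_J` of `w`. -/
noncomputable def parPart (J : Set B) (w : W) : W := (minRep cs J w)⁻¹ * w

/-- The J-Bruhat (twisted) order `≤^J` on `W`:
`v ≤^J w` iff there is `u ∈ W_J` with `v^J u ≤ w^J` and `w_J ≤ u⁻¹ v_J`. -/
def twistedLE (J : Set B) (v w : W) : Prop :=
  ∃ u ∈ parabolic cs J,
    bruhatLE cs (minRep cs J v * u) (minRep cs J w) ∧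
    bruhatLE cs (parPart cs J w) (u⁻¹ * parPart cs J v)

def twistedLT (J : Set B) (v w : W) : Prop := twistedLE cs J v w ∧ v ≠ w

def twistedCovBy (J : Set B) (v w : W) : Prop :=
  twistedLT cs J v w ∧ ¬ ∃ z, twistedLT cs J v z ∧ twistedLT cs J z w

/-- The J-length `ℓ^J(w) = ℓ(w^J) - ℓ(w_J)` (an integer). -/
noncomputable def twistedLength (J : Set B) (w : W) : ℤ :=
  (cs.length (minRep cs J w) : ℤ) - (cs.length (parPart cs J w) : ℤ)

/-! ### The reflection cocycle and the strong exchange property -/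

section StrongExchange

/-- The permutation `(t, ε) ↦ (s t s, ε + [t = s])` attached to the simple reflection `s`. -/
noncomputable def signedConj (i : B) : Equiv.Perm (W × ZMod 2) :=
  Function.Involutive.toPerm
    (fun p => (cs.simple i * p.1 * cs.simple i, p.2 + if p.1 = cs.simple i then 1 else 0)) (by
      rintro ⟨t, ε⟩
      have h : cs.simple i * t * cs.simple i = cs.simple i ↔ t = cs.simple i := by
        constructor
        · intro h
          have := congrArg (fun z => cs.simple i * z * cs.simple i) h
          simpa [mul_assoc] using this
        · rintro rfl
          simp
      have h2 : ∀ a : ZMod 2, a + a = 0 := by decide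
      simp only [h]
      ext
      · simp [mul_assoc]
      · simp [add_assoc, h2])

lemma signedConj_apply (i : B) (p : W × ZMod 2) :
    signedConj cs i p =
      (cs.simple i * p.1 * cs.simple i, p.2 + if p.1 = cs.simple i then 1 else 0) := rfl

lemma signedConj_mul_pow (i j : B) (n : ℕ) (t : W) (ε : ZMod 2) :
    ((signedConj cs i * signedConj cs j) ^ n) (t, ε) =
      ((cs.simple i * cs.simple j) ^ n * t * ((cs.simple i * cs.simple j) ^ n)⁻¹,
        ε + ∑ k ∈ Finset.range (2 * n),
          if (cs.simple i * cs.simple j) ^ k * t = cs.simple j then 1 else 0) := by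
  induction n with
  | zero => simp
  | succ n ih =>
    set ρ := cs.simple i * cs.simple j with hρ
    have hinv : cs.simple j * ρ⁻¹ = ρ * cs.simple j := by simp [hρ, mul_assoc]
    have hcomm : ∀ k : ℕ, cs.simple j * (ρ ^ k)⁻¹ = ρ ^ k * cs.simple j := by
      intro k
      induction k with
      | zero => simp
      | succ k ihk =>
        rw [pow_succ, mul_inv_rev, ← mul_assoc, hinv, mul_assoc, ihk, ← mul_assoc,
          (Commute.refl ρ).pow_right k |>.eq]
    have hc1 : ρ ^ n * t * (ρ ^ n)⁻¹ = cs.simple j ↔ ρ ^ (2 * n) * t = cs.simple j := by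
      have e3 : ρ ^ n * (cs.simple j * ρ ^ n) = cs.simple j := by
        rw [← mul_assoc, ← hcomm]
        simp
      rw [mul_inv_eq_iff_eq_mul, two_mul, pow_add, mul_assoc]
      constructor
      · intro h
        rw [h, e3]
      · intro h
        rw [← e3] at h
        exact mul_left_cancel h
    have hc2 : cs.simple j * (ρ ^ n * t * (ρ ^ n)⁻¹) * cs.simple j = cs.simple i ↔
        ρ ^ (2 * n + 1) * t = cs.simple j := by
      have e1 : cs.simple j * (ρ ^ n * t * (ρ ^ n)⁻¹) * cs.simple j = cs.simple i ↔
          ρ ^ n * t * (ρ ^ n)⁻¹ = ρ⁻¹ * cs.simple j := by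
        rw [← eq_mul_inv_iff_mul_eq, ← eq_inv_mul_iff_mul_eq]
        simp [hρ, mul_assoc]
      rw [e1, mul_inv_eq_iff_eq_mul]
      have e2 : ρ ^ (2 * n + 1) * t = ρ ^ (n + 1) * (ρ ^ n * t) := by
        rw [← mul_assoc, ← pow_add]; congr 2; omega
      have e3 : ρ ^ (n + 1) * (ρ⁻¹ * cs.simple j * ρ ^ n) = cs.simple j := by
        rw [pow_succ, ← mul_assoc, ← mul_assoc, mul_inv_cancel_right, ← hcomm]
        simp
      rw [e2]
      constructor
      · intro h
        rw [h, e3]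
      · intro h
        rw [← e3] at h
        exact mul_left_cancel h
    rw [pow_succ', Equiv.Perm.mul_apply, ih, Equiv.Perm.mul_apply, signedConj_apply,
      signedConj_apply]
    simp only [hc1, hc2]
    rw [show 2 * (n + 1) = 2 * n + 1 + 1 by ring, Finset.sum_range_succ, Finset.sum_range_succ]
    ext
    · simp [pow_succ', hρ, mul_assoc]
    · simp [add_assoc]

lemma isLiftable_signedConj : M.IsLiftable (signedConj cs) := by
  intro i j
  ext1 ⟨t, ε⟩
  rw [signedConj_mul_pow, two_mul, Finset.sum_range_add]
  have h2 : ∀ a : ZMod 2, a + a = 0 := by decide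
  simp [pow_add, h2]

/-- The action of `W` on `W × ℤ/2` extending `signedConj`. -/
noncomputable def signedAction : W →* Equiv.Perm (W × ZMod 2) :=
  cs.lift ⟨signedConj cs, isLiftable_signedConj cs⟩

lemma signedAction_simple (i : B) : signedAction cs (cs.simple i) = signedConj cs i :=
  cs.lift_apply_simple (isLiftable_signedConj cs) i

/-- The reflection cocycle: the parity of the number of occurrences of `t` in the right inversion
sequence of any word for `w`. -/
noncomputable def inversionParity (w t : W) : ZMod 2 := (signedAction cs w (t, 0)).2

lemma signedAction_wordProd (ω : List B) (t : W) (ε : ZMod 2) :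
    signedAction cs (cs.wordProd ω) (t, ε) =
      (cs.wordProd ω * t * (cs.wordProd ω)⁻¹, ε + ((cs.rightInvSeq ω).count t : ZMod 2)) := by
  induction ω with
  | nil => simp
  | cons i ω ih =>
    rw [cs.wordProd_cons, map_mul, Equiv.Perm.mul_apply, ih, signedAction_simple,
      signedConj_apply]
    have h : cs.wordProd ω * t * (cs.wordProd ω)⁻¹ = cs.simple i ↔
        (cs.wordProd ω)⁻¹ * cs.simple i * cs.wordProd ω = t := by
      rw [mul_inv_eq_iff_eq_mul, mul_assoc, inv_mul_eq_iff_eq_mul, eq_comm]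
    ext
    · simp [mul_assoc]
    · simp only [h, CoxeterSystem.rightInvSeq, List.count_cons, beq_iff_eq]
      push_cast
      rw [add_assoc]

lemma signedAction_apply (w t : W) (ε : ZMod 2) :
    signedAction cs w (t, ε) = (w * t * w⁻¹, ε + inversionParity cs w t) := by
  obtain ⟨ω, rfl⟩ := cs.wordProd_surjective w
  simp [inversionParity, signedAction_wordProd]

lemma inversionParity_wordProd (ω : List B) (t : W) :
    inversionParity cs (cs.wordProd ω) t = ((cs.rightInvSeq ω).count t : ZMod 2) := by
  simp [inversionParity, signedAction_wordProd]

lemma inversionParity_mul (a b t : W) :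
    inversionParity cs (a * b) t =
      inversionParity cs b t + inversionParity cs a (b * t * b⁻¹) := by
  rw [inversionParity, map_mul, Equiv.Perm.mul_apply, signedAction_apply, signedAction_apply]
  simp

lemma inversionParity_one (t : W) : inversionParity cs 1 t = 0 := by
  simp [inversionParity]

lemma inversionParity_simple (i : B) (t : W) :
    inversionParity cs (cs.simple i) t = if t = cs.simple i then 1 else 0 := by
  simp [inversionParity, signedAction_simple, signedConj_apply]

lemma inversionParity_self {t : W} (ht : cs.IsReflection t) : inversionParity cs t t = 1 := by
  obtain ⟨w, i, rfl⟩ := ht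
  have h := inversionParity_mul cs w w⁻¹ (w * cs.simple i * w⁻¹)
  rw [mul_inv_cancel, inversionParity_one] at h
  rw [inversionParity_mul, inversionParity_mul, inversionParity_simple]
  simp only [mul_assoc, inv_mul_cancel_left, inv_inv, inv_mul_cancel, mul_one,
    CoxeterSystem.simple_mul_simple_self, CoxeterSystem.inv_simple, if_true] at h ⊢
  rw [one_mul, add_left_comm, ← h, add_zero]

/-- For a reduced word, the cocycle detects membership in the right inversion sequence. -/
lemma inversionParity_eq_one_iff_mem {ω : List B} (hω : cs.IsReduced ω) (t : W) :
    inversionParity cs (cs.wordProd ω) t = 1 ↔ t ∈ cs.rightInvSeq ω := by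
  rw [inversionParity_wordProd]
  by_cases ht : t ∈ cs.rightInvSeq ω
  · simp [ht, List.count_eq_one_of_mem hω.nodup_rightInvSeq ht]
  · simp [ht, List.count_eq_zero_of_not_mem ht]

lemma inversionParity_eq_one_iff {t : W} (ht : cs.IsReflection t) (w : W) :
    inversionParity cs w t = 1 ↔ cs.length (w * t) < cs.length w := by
  have key : ∀ w, inversionParity cs w t = 1 → cs.length (w * t) < cs.length w := by
    intro w h
    obtain ⟨ω, hω, rfl⟩ := cs.exists_isReduced w
    exact (cs.isRightInversion_of_mem_rightInvSeq hω
      ((inversionParity_eq_one_iff_mem cs hω t).1 h)).2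
  refine ⟨key w, fun h => ?_⟩
  by_contra hne
  have h0 : inversionParity cs w t = 0 := by
    revert hne
    generalize inversionParity cs w t = a
    revert a
    decide
  have h1 := key (w * t) (by
    rw [inversionParity_mul, inversionParity_self cs ht, mul_assoc, mul_inv_cancel, mul_one, h0,
      add_zero])
  rw [mul_assoc, ht.mul_self, mul_one] at h1
  omega

/-- The strong exchange property. -/
lemma exists_eraseIdx_of_length_mul_lt {ω : List B} (hω : cs.IsReduced ω) {t : W}
    (ht : cs.IsReflection t) (h : cs.length (cs.wordProd ω * t) < cs.length (cs.wordProd ω)) :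
    ∃ j < ω.length, cs.wordProd ω * t = cs.wordProd (ω.eraseIdx j) := by
  have hm := (inversionParity_eq_one_iff_mem cs hω t).1 ((inversionParity_eq_one_iff cs ht _).2 h)
  obtain ⟨j, hj, rfl⟩ := List.mem_iff_getElem.mp hm
  refine ⟨j, by simpa using hj, ?_⟩
  rw [← List.getD_eq_getElem _ 1 hj, cs.wordProd_mul_getD_rightInvSeq]

/-- The cocycle identity, stated in terms of lengths. -/
lemma length_mul_mul_lt_iff (a b : W) {t : W} (ht : cs.IsReflection t) :
    cs.length (a * b * t) < cs.length (a * b) ↔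
      Xor (cs.length (b * t) < cs.length b)
        (cs.length (a * (b * t * b⁻¹)) < cs.length a) := by
  rw [← inversionParity_eq_one_iff cs ht, ← inversionParity_eq_one_iff cs ht,
    ← inversionParity_eq_one_iff cs (ht.conj b), inversionParity_mul]
  generalize inversionParity cs b t = x
  generalize inversionParity cs a (b * t * b⁻¹) = y
  revert x y
  unfold Xor
  decide

lemma length_simple_mul_lt_iff (i : B) {t : W} (ht : cs.IsReflection t) :
    cs.length (cs.simple i * t) < cs.length (cs.simple i) ↔ t = cs.simple i := by
  rw [← inversionParity_eq_one_iff cs ht, inversionParity_simple]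
  simp

end StrongExchange

/-! ### The Bruhat order via reflections, and its lifting property -/

section BruhatChain

/-- `y = x t` for a reflection `t`, and `ℓ x < ℓ y`. -/
def BruhatStep (x y : W) : Prop :=
  ∃ t, cs.IsReflection t ∧ y = x * t ∧ cs.length x < cs.length y

/-- The Bruhat order, as the reflexive transitive closure of `BruhatStep`. -/
def BruhatChain : W → W → Prop := Relation.ReflTransGen (BruhatStep cs)

variable {cs}

lemma BruhatChain.rfl {x : W} : BruhatChain cs x x := Relation.ReflTransGen.refl

lemma BruhatChain.trans {x y z : W} (h : BruhatChain cs x y) (h' : BruhatChain cs y z) :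
    BruhatChain cs x z := Relation.ReflTransGen.trans h h'

lemma BruhatChain.length_le {x y : W} (h : BruhatChain cs x y) :
    cs.length x ≤ cs.length y := by
  induction h with
  | refl => exact le_rfl
  | tail _ h ih =>
    obtain ⟨t, -, -, h⟩ := h
    omega

lemma BruhatChain.eq_of_length_le {x y : W} (h : BruhatChain cs x y)
    (hl : cs.length y ≤ cs.length x) : x = y := by
  induction h with
  | refl => rfl
  | tail h h' ih =>
    have := BruhatChain.length_le h
    obtain ⟨t, -, -, h'⟩ := h'
    omega

lemma BruhatStep.inv {x y : W} (h : BruhatStep cs x y) : BruhatStep cs x⁻¹ y⁻¹ := by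
  obtain ⟨t, ht, rfl, hl⟩ := h
  refine ⟨x * t * x⁻¹, ht.conj x, ?_, by rwa [cs.length_inv, cs.length_inv]⟩
  simp [ht.inv, mul_assoc]

lemma BruhatChain.inv {x y : W} (h : BruhatChain cs x y) : BruhatChain cs x⁻¹ y⁻¹ := by
  induction h with
  | refl => exact .rfl
  | tail _ h ih => exact .tail ih h.inv

lemma BruhatChain.of_simple_mul {x : W} {i : B} (h : cs.length x < cs.length (cs.simple i * x)) :
    BruhatChain cs x (cs.simple i * x) := by
  refine .single ⟨x⁻¹ * cs.simple i * x, ?_, by simp [mul_assoc], h⟩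
  simpa using (cs.isReflection_simple i).conj x⁻¹

lemma BruhatChain.simple_mul_self {x : W} {i : B}
    (h : cs.length (cs.simple i * x) < cs.length x) : BruhatChain cs (cs.simple i * x) x := by
  have := BruhatChain.of_simple_mul (cs := cs) (x := cs.simple i * x) (i := i)
    (by rwa [cs.simple_mul_simple_cancel_left])
  rwa [cs.simple_mul_simple_cancel_left] at this

lemma BruhatStep.simple_mul {x y : W} (h : BruhatStep cs x y) (i : B) :
    cs.simple i * x = y ∨ BruhatStep cs (cs.simple i * x) (cs.simple i * y) := by
  obtain ⟨t, ht, rfl, hl⟩ := h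
  by_cases he : x * t * x⁻¹ = cs.simple i
  · left
    rw [← he]
    simp
  · right
    refine ⟨t, ht, (mul_assoc _ _ _).symm, ?_⟩
    have h1 := length_mul_mul_lt_iff cs (cs.simple i) x ht
    rw [length_simple_mul_lt_iff cs i (ht.conj x), xor_iff_or_and_not_and] at h1
    have h2 : ¬ cs.length (cs.simple i * x * t) < cs.length (cs.simple i * x) := by
      rw [h1]
      rintro ⟨h | h, -⟩
      · omega
      · exact he h
    have h3 := ht.length_mul_left_ne (cs.simple i * x)
    rw [mul_assoc] at h2 h3
    omega

lemma BruhatChain.le_simple_mul_or {x y : W} (h : BruhatChain cs x y) (i : B) :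
    BruhatChain cs x (cs.simple i * y) ∨
      BruhatChain cs (cs.simple i * x) (cs.simple i * y) := by
  induction h with
  | refl => exact .inr .rfl
  | tail h h' ih =>
    rcases h'.simple_mul i with he | hs
    · left
      rw [← he, cs.simple_mul_simple_cancel_left]
      exact h
    · exact ih.imp (fun h => h.trans (.single hs)) (fun h => h.trans (.single hs))

lemma BruhatChain.simple_mul_le_or {x y : W} (h : BruhatChain cs x y) (i : B) :
    BruhatChain cs (cs.simple i * x) y ∨
      BruhatChain cs (cs.simple i * x) (cs.simple i * y) := by
  induction h using Relation.ReflTransGen.head_induction_on with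
  | refl => exact .inr .rfl
  | head h h' ih =>
    rcases h.simple_mul i with he | hs
    · left
      rwa [he]
    · exact ih.imp (fun h => .head hs h) (fun h => .head hs h)

lemma BruhatChain.le_simple_mul {x y : W} {i : B} (h : BruhatChain cs x y)
    (hx : cs.length x < cs.length (cs.simple i * x)) : BruhatChain cs x (cs.simple i * y) :=
  (h.le_simple_mul_or i).elim id fun h => (BruhatChain.of_simple_mul hx).trans h

lemma BruhatChain.simple_mul_le {x y : W} {i : B} (h : BruhatChain cs x y)
    (hy : cs.length (cs.simple i * y) < cs.length y) : BruhatChain cs (cs.simple i * x) y :=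
  (h.simple_mul_le_or i).elim id fun h => h.trans (BruhatChain.simple_mul_self hy)

lemma BruhatChain.simple_mul_le_simple_mul {x y : W} {i : B} (h : BruhatChain cs x y)
    (hy : cs.length y < cs.length (cs.simple i * y)) :
    BruhatChain cs (cs.simple i * x) (cs.simple i * y) :=
  (h.simple_mul_le_or i).elim (fun h => h.trans (BruhatChain.of_simple_mul hy)) id

lemma length_inv_mul_simple (x : W) (i : B) :
    cs.length (cs.simple i * x⁻¹) = cs.length (x * cs.simple i) := by
  rw [← cs.length_inv]
  simp

lemma BruhatChain.mul_simple_self {x : W} {i : B}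
    (h : cs.length (x * cs.simple i) < cs.length x) : BruhatChain cs (x * cs.simple i) x := by
  simpa using (BruhatChain.simple_mul_self (x := x⁻¹) (i := i)
    (by rwa [length_inv_mul_simple, cs.length_inv])).inv

lemma BruhatChain.of_mul_simple {x : W} {i : B} (h : cs.length x < cs.length (x * cs.simple i)) :
    BruhatChain cs x (x * cs.simple i) := by
  simpa using (BruhatChain.of_simple_mul (x := x⁻¹) (i := i)
    (by rwa [length_inv_mul_simple, cs.length_inv])).inv

lemma BruhatChain.le_mul_simple {x y : W} {i : B} (h : BruhatChain cs x y)
    (hx : cs.length x < cs.length (x * cs.simple i)) : BruhatChain cs x (y * cs.simple i) := by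
  simpa using (h.inv.le_simple_mul (i := i)
    (by rwa [length_inv_mul_simple, cs.length_inv])).inv

lemma BruhatChain.mul_simple_le_mul_simple {x y : W} {i : B} (h : BruhatChain cs x y)
    (hy : cs.length y < cs.length (y * cs.simple i)) :
    BruhatChain cs (x * cs.simple i) (y * cs.simple i) := by
  simpa using (h.inv.simple_mul_le_simple_mul (i := i)
    (by rwa [length_inv_mul_simple, cs.length_inv])).inv

/-- Inserting a simple reflection between `a` and `b` goes up in Bruhat order as soon as it
lengthens both `a` and `b`. -/
lemma BruhatChain.mul_le_mul_simple_mul {a b : W} {i : B}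
    (ha : cs.length a < cs.length (a * cs.simple i))
    (hb : cs.length b < cs.length (cs.simple i * b)) :
    BruhatChain cs (a * b) (a * cs.simple i * b) := by
  have ht : cs.IsReflection (b⁻¹ * cs.simple i * b) := by
    simpa using (cs.isReflection_simple i).conj b⁻¹
  have he : a * cs.simple i * b = a * b * (b⁻¹ * cs.simple i * b) := by simp [mul_assoc]
  have h1 := length_mul_mul_lt_iff cs a b ht
  have h2 : b * (b⁻¹ * cs.simple i * b) = cs.simple i * b := by simp [mul_assoc]
  rw [h2, mul_inv_cancel_right, xor_iff_or_and_not_and] at h1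
  refine .single ⟨_, ht, he, ?_⟩
  rw [he]
  have h3 := ht.length_mul_left_ne (a * b)
  omega

/-! ### The subword property -/

lemma exists_reduced_sublist (ω : List B) :
    ∃ ω' : List B, ω'.Sublist ω ∧ cs.IsReduced ω' ∧ cs.wordProd ω' = cs.wordProd ω := by
  induction ω with
  | nil => exact ⟨[], .slnil, by simp [CoxeterSystem.IsReduced], rfl⟩
  | cons i ω ih =>
    obtain ⟨ω', hs, hr, he⟩ := ih
    by_cases h : cs.length (cs.simple i * cs.wordProd ω') < cs.length (cs.wordProd ω')
    · have ht : cs.IsReflection ((cs.wordProd ω')⁻¹ * cs.simple i * cs.wordProd ω') := by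
        simpa using (cs.isReflection_simple i).conj (cs.wordProd ω')⁻¹
      have hm : cs.wordProd ω' * ((cs.wordProd ω')⁻¹ * cs.simple i * cs.wordProd ω') =
          cs.simple i * cs.wordProd ω' := by simp [mul_assoc]
      obtain ⟨j, hj, hje⟩ := exists_eraseIdx_of_length_mul_lt cs hr ht (by rwa [hm])
      rw [hm] at hje
      refine ⟨ω'.eraseIdx j, ((List.eraseIdx_sublist ω' j).trans hs).cons i, ?_, ?_⟩
      · have := List.length_eraseIdx_add_one hj
        have := cs.isLeftDescent_iff.1 h
        have := hr.eq
        rw [CoxeterSystem.IsReduced, ← hje]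
        omega
      · rw [← hje, cs.wordProd_cons, he]
    · refine ⟨i :: ω', hs.cons_cons i, ?_, by rw [cs.wordProd_cons, cs.wordProd_cons, he]⟩
      rw [CoxeterSystem.IsReduced, cs.wordProd_cons, cs.not_isLeftDescent_iff.1 h, hr.eq,
        List.length_cons]

lemma BruhatChain.exists_sublist {x y : W} (h : BruhatChain cs x y) :
    ∀ ω : List B, cs.IsReduced ω → cs.wordProd ω = y →
      ∃ ω' : List B, ω'.Sublist ω ∧ cs.wordProd ω' = x := by
  induction h with
  | refl => exact fun ω _ h => ⟨ω, .refl ω, h⟩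
  | @tail b _ _ h ih =>
    obtain ⟨t, ht, rfl, hl⟩ := h
    intro ω hω he
    have hb : cs.wordProd ω * t = b := by rw [he, mul_assoc, ht.mul_self, mul_one]
    obtain ⟨j, hj, hje⟩ := exists_eraseIdx_of_length_mul_lt cs hω ht (by rwa [hb, he])
    obtain ⟨ω₁, hs, hr, he₁⟩ := exists_reduced_sublist (cs := cs) (ω.eraseIdx j)
    obtain ⟨ω₂, hs₂, he₂⟩ := ih ω₁ hr (by rw [he₁, ← hje, hb])
    exact ⟨ω₂, hs₂.trans (hs.trans (List.eraseIdx_sublist ω j)), he₂⟩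

lemma bruhatChain_of_sublist {ω ω' : List B} (hs : ω'.Sublist ω) (hω : cs.IsReduced ω) :
    BruhatChain cs (cs.wordProd ω') (cs.wordProd ω) := by
  induction hs with
  | slnil => exact .rfl
  | cons i _ ih =>
    have hr := hω.drop 1
    have hl := hω.eq
    rw [List.drop_one, List.tail_cons] at hr
    rw [cs.wordProd_cons] at hl ⊢
    refine (ih hr).trans (BruhatChain.of_simple_mul ?_)
    rw [hl, hr.eq, List.length_cons]
    omega
  | cons_cons i _ ih =>
    have hr := hω.drop 1
    have hl := hω.eq
    rw [List.drop_one, List.tail_cons] at hr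
    rw [cs.wordProd_cons] at hl
    rw [cs.wordProd_cons, cs.wordProd_cons]
    refine (ih hr).simple_mul_le_simple_mul ?_
    rw [hl, hr.eq, List.length_cons]
    omega

lemma bruhatLE_iff_bruhatChain {x y : W} : bruhatLE cs x y ↔ BruhatChain cs x y := by
  constructor
  · rintro ⟨ω, hω, rfl, ω', hs, rfl⟩
    exact bruhatChain_of_sublist hs hω
  · intro h
    obtain ⟨ω, hω, rfl⟩ := cs.exists_isReduced y
    exact ⟨ω, hω, rfl, h.exists_sublist ω hω rfl⟩

end BruhatChain

/-! ### Thinness from a lifting property -/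

section Lifting

/-- There are exactly two elements of rank `ρ u + 1` between `u` and `w`. -/
def HasTwoMiddles {P : Type*} (le : P → P → Prop) (ρ : P → ℤ) (u w : P) : Prop :=
  ∃ a b, a ≠ b ∧ ∀ z, (le u z ∧ le z w ∧ ρ z = ρ u + 1) ↔ z = a ∨ z = b

/-- A transitive relation with a strict rank function and an involution `σ` that moves every
element up or down by one and satisfies the lifting property. -/
structure LiftingInvolution {P : Type*} (le : P → P → Prop) (ρ : P → ℤ) (σ : P → P) : Prop where
  trans : ∀ x y z, le x y → le y z → le x z
  eq_of_rank : ∀ x y, le x y → ρ y ≤ ρ x → x = y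
  invol : ∀ x, σ (σ x) = x
  rank : ∀ x, ρ (σ x) = ρ x + 1 ∨ ρ (σ x) = ρ x - 1
  le_self : ∀ x, ρ (σ x) < ρ x → le (σ x) x
  lift : ∀ x y, le x y → ρ x < ρ (σ x) → ρ (σ y) < ρ y → le (σ x) y ∧ le x (σ y)

namespace LiftingInvolution

variable {P : Type*} {le : P → P → Prop} {ρ : P → ℤ} {σ : P → P} {u w : P}

lemma hasTwoMiddles_of_ascent (h : LiftingInvolution le ρ σ) (huw : le u w)
    (hr : ρ w = ρ u + 2) (hw : ρ (σ w) < ρ w) (hu : ρ u < ρ (σ u)) :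
    HasTwoMiddles le ρ u w := by
  obtain ⟨h1, h2⟩ := h.lift u w huw hu hw
  have hru := h.rank u
  have hrw := h.rank w
  have hiu := h.invol u
  have hsu : le u (σ u) := by
    have := h.le_self (σ u)
    rw [hiu] at this
    exact this hu
  refine ⟨σ w, σ u, fun he => ?_, fun z => ⟨?_, ?_⟩⟩
  · have : w = u := by rw [← h.invol w, he, hiu]
    rw [this] at hr
    omega
  · rintro ⟨hz1, hz2, hz3⟩
    rcases h.rank z with hz | hz
    · left
      exact h.eq_of_rank _ _ (h.lift z w hz2 (by omega) hw).2 (by omega)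
    · right
      exact (h.eq_of_rank _ _ (h.lift u z hz1 hu (by omega)).1 (by omega)).symm
  · rintro (rfl | rfl)
    · exact ⟨h2, h.le_self _ hw, by omega⟩
    · exact ⟨hsu, h1, by omega⟩

lemma le_of_descents (h : LiftingInvolution le ρ σ) (huw : le u w) (hw : ρ (σ w) < ρ w)
    (hu : ρ (σ u) < ρ u) : le (σ u) (σ w) :=
  (h.lift (σ u) w (h.trans _ _ _ (h.le_self u hu) huw) (by rwa [h.invol]) hw).2

lemma hasTwoMiddles_of_descent (h : LiftingInvolution le ρ σ) (huw : le u w)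
    (hr : ρ w = ρ u + 2) (hw : ρ (σ w) < ρ w) (hu : ρ (σ u) < ρ u)
    (hm : HasTwoMiddles le ρ (σ u) (σ w)) : HasTwoMiddles le ρ u w := by
  have hru := h.rank u
  have hrw := h.rank w
  have hinj : Function.Injective σ := Function.Involutive.injective h.invol
  have hdown : ∀ z, le u z → le z w → ρ z = ρ u + 1 → ρ (σ z) < ρ z →
      le (σ u) (σ z) ∧ le (σ z) (σ w) ∧ ρ (σ z) = ρ (σ u) + 1 := by
    intro z h1 h2 h3 h4
    have hrz := h.rank z
    exact ⟨h.le_of_descents h1 h4 hu, h.le_of_descents h2 hw h4, by omega⟩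
  have hup : ∀ z, le u z → le z w → ρ z = ρ u + 1 → ρ z < ρ (σ z) → z = σ w := by
    intro z h1 h2 h3 h4
    exact h.eq_of_rank _ _ (h.lift z w h2 h4 hw).2 (by omega)
  have hlift : ∀ a, le (σ u) a → le a (σ w) → ρ a = ρ (σ u) + 1 → ρ a < ρ (σ a) →
      le u (σ a) ∧ le (σ a) w ∧ ρ (σ a) = ρ u + 1 := by
    intro a h1 h2 h3 h4
    have hra := h.rank a
    have haa : ρ (σ (σ a)) < ρ (σ a) := by rwa [h.invol]
    have hsa : le a (σ a) := by simpa [h.invol] using h.le_self (σ a) haa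
    refine ⟨?_, (h.lift a w (h.trans _ _ _ h2 (h.le_self w hw)) h4 hw).1, by omega⟩
    have := (h.lift (σ u) (σ a) (h.trans _ _ _ h1 hsa) (by rwa [h.invol]) haa).1
    rwa [h.invol] at this
  have hdesc : ∀ a, le (σ u) a → ρ a = ρ (σ u) + 1 → ρ (σ a) < ρ a → a = u := by
    intro a h1 h3 h4
    have := (h.lift (σ u) a h1 (by rwa [h.invol]) h4).1
    rw [h.invol] at this
    exact (h.eq_of_rank _ _ this (by omega)).symm
  have hsplit : ∀ z, ρ z < ρ (σ z) ∨ ρ (σ z) < ρ z := by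
    intro z
    have := h.rank z
    omega
  -- the case where one of the two middle elements of the lower interval is `u`
  have case_mem : ∀ b, b ≠ u →
      (∀ z, (le (σ u) z ∧ le z (σ w) ∧ ρ z = ρ (σ u) + 1) ↔ z = u ∨ z = b) →
      HasTwoMiddles le ρ u w := by
    intro b hb hm
    obtain ⟨b1, b2, b3⟩ := (hm b).2 (.inr rfl)
    have hbu : ρ b < ρ (σ b) := (hsplit b).resolve_right fun h' => hb (hdesc b b1 b3 h')
    refine ⟨σ b, σ w, fun he => ?_, fun z => ⟨?_, ?_⟩⟩
    · have hbw := hinj he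
      rw [hbw] at b3
      omega
    · rintro ⟨z1, z2, z3⟩
      rcases hsplit z with hz | hz
      · exact .inr (hup z z1 z2 z3 hz)
      · left
        rcases (hm (σ z)).1 (hdown z z1 z2 z3 hz) with he | he
        · rw [← he, h.invol] at hu
          omega
        · rw [← he, h.invol]
    · rintro (rfl | rfl)
      · exact hlift b b1 b2 b3 hbu
      · exact ⟨((hm u).2 (.inl rfl)).2.1, h.le_self w hw, by omega⟩
  obtain ⟨a, b, hab, hm⟩ := hm
  by_cases ha : a = u
  · subst ha
    exact case_mem b (Ne.symm hab) hm
  by_cases hb : b = u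
  · subst hb
    exact case_mem a ha fun z => (hm z).trans or_comm
  obtain ⟨a1, a2, a3⟩ := (hm a).2 (.inl rfl)
  obtain ⟨b1, b2, b3⟩ := (hm b).2 (.inr rfl)
  have hau : ρ a < ρ (σ a) := (hsplit a).resolve_right fun h' => ha (hdesc a a1 a3 h')
  have hbu : ρ b < ρ (σ b) := (hsplit b).resolve_right fun h' => hb (hdesc b b1 b3 h')
  refine ⟨σ a, σ b, fun he => hab (hinj he), fun z => ⟨?_, ?_⟩⟩
  · rintro ⟨z1, z2, z3⟩
    rcases hsplit z with hz | hz
    · exfalso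
      have he := hup z z1 z2 z3 hz
      rw [he] at z1
      rcases (hm u).1 ⟨h.le_self u hu, z1, by omega⟩ with h' | h'
      · exact ha h'.symm
      · exact hb h'.symm
    · refine ((hm (σ z)).1 (hdown z z1 z2 z3 hz)).imp ?_ ?_ <;>
      · rintro rfl
        rw [h.invol]
  · rintro (rfl | rfl)
    · exact hlift a a1 a2 a3 hau
    · exact hlift b b1 b2 b3 hbu

end LiftingInvolution

lemma HasTwoMiddles.ncard_eq_four {P : Type*} {le : P → P → Prop} {ρ : P → ℤ} {u w : P}
    (hrefl : ∀ x, le x x) (hmono : ∀ x y, le x y → ρ x ≤ ρ y)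
    (heq : ∀ x y, le x y → ρ y ≤ ρ x → x = y) (huw : le u w) (hr : ρ w = ρ u + 2)
    (h : HasTwoMiddles le ρ u w) : {z | le u z ∧ le z w}.ncard = 4 := by
  obtain ⟨a, b, hab, hm⟩ := h
  have ha := (hm a).2 (.inl rfl)
  have hb := (hm b).2 (.inr rfl)
  have hset : {z | le u z ∧ le z w} = ({u, a, b, w} : Finset P) := by
    ext z
    simp only [Set.mem_ofPred_eq, Finset.coe_insert, Finset.coe_singleton, Set.mem_insert_iff,
      Set.mem_singleton_iff]
    constructor
    · rintro ⟨h1, h2⟩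
      have r1 := hmono _ _ h1
      have r2 := hmono _ _ h2
      rcases (by omega : ρ z ≤ ρ u ∨ ρ z = ρ u + 1 ∨ ρ w ≤ ρ z) with h3 | h3 | h3
      · exact .inl (heq _ _ h1 h3).symm
      · exact .inr (((hm z).1 ⟨h1, h2, h3⟩).imp id .inl)
      · exact .inr (.inr (.inr (heq _ _ h2 h3)))
    · rintro (rfl | rfl | rfl | rfl)
      · exact ⟨hrefl _, huw⟩
      · exact ⟨ha.1, ha.2.1⟩
      · exact ⟨hb.1, hb.2.1⟩
      · exact ⟨huw, hrefl _⟩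
  have hne : ∀ {x y : P}, ρ x ≠ ρ y → x ≠ y := fun h he => h (by rw [he])
  rw [hset, Set.ncard_coe_finset, Finset.card_insert_of_notMem, Finset.card_insert_of_notMem,
    Finset.card_pair]
  · exact hne (by omega)
  · simp only [Finset.mem_insert, Finset.mem_singleton, not_or]
    exact ⟨hab, hne (by omega)⟩
  · simp only [Finset.mem_insert, Finset.mem_singleton, not_or]
    exact ⟨hne (by omega), hne (by omega), hne (by omega)⟩

end Lifting

/-! ### Bruhat intervals of length two -/

section BruhatThin

lemma liftingInvolution_bruhatChain (i : B) :
    LiftingInvolution (BruhatChain cs) (fun x => (cs.length x : ℤ)) (fun x => cs.simple i * x) where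
  trans _ _ _ := BruhatChain.trans
  eq_of_rank _ _ h h' := h.eq_of_length_le (by exact_mod_cast h')
  invol _ := cs.simple_mul_simple_cancel_left i
  rank x := by
    have := cs.length_simple_mul x i
    omega
  le_self _ h := BruhatChain.simple_mul_self (by exact_mod_cast h)
  lift _ _ h h1 h2 := ⟨h.simple_mul_le (by exact_mod_cast h2), h.le_simple_mul (by exact_mod_cast h1)⟩

lemma hasTwoMiddles_bruhatChain {u w : W} (h : BruhatChain cs u w)
    (hl : cs.length w = cs.length u + 2) :
    HasTwoMiddles (BruhatChain cs) (fun x => (cs.length x : ℤ)) u w := by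
  induction hn : cs.length w generalizing u w with
  | zero => omega
  | succ n ih =>
    obtain ⟨i, hi⟩ := cs.exists_leftDescent_of_ne_one (w := w) (by
      rintro rfl
      simp at hn)
    have hw := cs.isLeftDescent_iff.1 hi
    have hL := liftingInvolution_bruhatChain cs i
    have hl' : (cs.length w : ℤ) = (cs.length u : ℤ) + 2 := by exact_mod_cast hl
    have hw' : (cs.length (cs.simple i * w) : ℤ) < cs.length w := by omega
    rcases cs.length_simple_mul u i with hu | hu
    · exact hL.hasTwoMiddles_of_ascent h hl' hw' (by omega)
    · have hu' : (cs.length (cs.simple i * u) : ℤ) < cs.length u := by omega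
      exact hL.hasTwoMiddles_of_descent h hl' hw' hu'
        (ih (hL.le_of_descents h hw' hu') (by omega) (by omega))

end BruhatThin

/-! ### Minimal coset representatives -/

section Parabolic

/-- `x` is a minimal-length representative of its coset `x W_J`. -/
def IsMinRep (J : Set B) (x : W) : Prop :=
  ∀ u ∈ parabolic cs J, cs.length x ≤ cs.length (x * u)

variable {cs} {J : Set B}

lemma parabolic_induction_right {p : W → Prop} (one : p 1)
    (mul : ∀ u ∈ parabolic cs J, ∀ i, cs.simple i ∈ parabolic cs J → p u → p (u * cs.simple i))
    {u : W} (hu : u ∈ parabolic cs J) : p u := by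
  unfold parabolic at hu
  induction hu using Subgroup.closure_induction_right with
  | one => exact one
  | mul_right x hx y hy ih =>
    obtain ⟨i, hi, rfl⟩ := hy
    exact mul x hx i (Subgroup.subset_closure ⟨i, hi, rfl⟩) ih
  | mul_inv_cancel x hx y hy ih =>
    obtain ⟨i, hi, rfl⟩ := hy
    rw [cs.inv_simple]
    exact mul x hx i (Subgroup.subset_closure ⟨i, hi, rfl⟩) ih

/-- The right inversions of an element of `W_J` lie in `W_J`. -/
lemma mem_parabolic_of_length_mul_lt {u t : W} (hu : u ∈ parabolic cs J)
    (ht : cs.IsReflection t) (h : cs.length (u * t) < cs.length u) : t ∈ parabolic cs J := by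
  revert t
  refine parabolic_induction_right (p := fun u => ∀ {t : W}, cs.IsReflection t →
    cs.length (u * t) < cs.length u → t ∈ parabolic cs J) ?_ ?_ hu
  · intro t _ h
    simp at h
  · intro u _ i hi ih t ht h
    rw [length_mul_mul_lt_iff cs u (cs.simple i) ht, length_simple_mul_lt_iff cs i ht] at h
    rcases h with ⟨rfl, -⟩ | ⟨h, -⟩
    · exact hi
    · have hm := ih (ht.conj _) h
      have := mul_mem (mul_mem (inv_mem hi) hm) hi
      simpa [mul_assoc] using this

lemma BruhatChain.mem_parabolic {x y : W} (h : BruhatChain cs x y) (hy : y ∈ parabolic cs J) :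
    x ∈ parabolic cs J := by
  induction h with
  | refl => exact hy
  | tail _ h ih =>
    obtain ⟨t, ht, rfl, hl⟩ := h
    refine ih ?_
    have htm := mem_parabolic_of_length_mul_lt hy ht (by rwa [mul_assoc, ht.mul_self, mul_one])
    have := mul_mem hy htm
    rwa [mul_assoc, ht.mul_self, mul_one] at this

lemma IsMinRep.length_mul_simple_lt_iff {x u : W} (hx : IsMinRep cs J x)
    (hu : u ∈ parabolic cs J) {i : B} (hi : cs.simple i ∈ parabolic cs J) :
    cs.length (x * u * cs.simple i) < cs.length (x * u) ↔
      cs.length (u * cs.simple i) < cs.length u := by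
  rw [length_mul_mul_lt_iff cs x u (cs.isReflection_simple i), xor_iff_or_and_not_and]
  have := hx _ (mul_mem (mul_mem hu hi) (inv_mem hu))
  constructor
  · rintro ⟨h | h, -⟩
    · exact h
    · omega
  · exact fun h => ⟨.inl h, fun h' => by omega⟩

lemma IsMinRep.length_mul {x u : W} (hx : IsMinRep cs J x) (hu : u ∈ parabolic cs J) :
    cs.length (x * u) = cs.length x + cs.length u := by
  refine parabolic_induction_right
    (p := fun u => cs.length (x * u) = cs.length x + cs.length u) (by simp) ?_ hu
  intro u hu i hi ih
  have h := hx.length_mul_simple_lt_iff hu hi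
  have h1 := cs.length_mul_simple u i
  have h2 := cs.length_mul_simple (x * u) i
  rw [← mul_assoc]
  omega

lemma IsMinRep.eq_and_eq {x x' y y' : W} (hx : IsMinRep cs J x) (hx' : IsMinRep cs J x')
    (hy : y ∈ parabolic cs J) (hy' : y' ∈ parabolic cs J) (h : x * y = x' * y') :
    x = x' ∧ y = y' := by
  have e1 : x * (y * y'⁻¹) = x' := by rw [← mul_assoc, h, mul_inv_cancel_right]
  have e2 : x' * (y' * y⁻¹) = x := by rw [← mul_assoc, ← h, mul_inv_cancel_right]
  have l1 := hx.length_mul (mul_mem hy (inv_mem hy'))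
  have l2 := hx'.length_mul (mul_mem hy' (inv_mem hy))
  rw [e1] at l1
  rw [e2] at l2
  have h0 : y * y'⁻¹ = 1 := cs.length_eq_zero_iff.1 (by omega)
  rw [h0, mul_one] at e1
  exact ⟨e1, mul_inv_eq_one.1 h0⟩

lemma isMinRep_minRep (w : W) : IsMinRep cs J (minRep cs J w) := by
  obtain ⟨h1, h2⟩ := (exists_minRep cs J w).choose_spec
  intro u hu
  refine h2 _ ?_
  rw [mul_inv_rev, mul_assoc]
  exact mul_mem (inv_mem hu) h1

lemma parPart_mem (w : W) : parPart cs J w ∈ parabolic cs J :=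
  (exists_minRep cs J w).choose_spec.1

lemma minRep_mul_parPart (w : W) : minRep cs J w * parPart cs J w = w := by
  simp [parPart]

lemma IsMinRep.minRep_mul {x y : W} (hx : IsMinRep cs J x) (hy : y ∈ parabolic cs J) :
    minRep cs J (x * y) = x ∧ parPart cs J (x * y) = y :=
  (isMinRep_minRep _).eq_and_eq hx (parPart_mem _) hy (minRep_mul_parPart _)

/-- Deodhar's lemma. -/
lemma IsMinRep.simple_mul {x : W} (hx : IsMinRep cs J x) (i : B) :
    IsMinRep cs J (cs.simple i * x) ∨
      ∃ j, cs.simple j ∈ parabolic cs J ∧ cs.simple i * x = x * cs.simple j := by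
  set x' := minRep cs J (cs.simple i * x) with hx'
  set u := parPart cs J (cs.simple i * x) with hu
  have hmin : IsMinRep cs J x' := isMinRep_minRep _
  have hum : u ∈ parabolic cs J := parPart_mem _
  have he : x' * u = cs.simple i * x := minRep_mul_parPart _
  have l1 := hmin.length_mul hum
  rw [he] at l1
  have l2 := cs.length_simple_mul x i
  have l3 := cs.length_simple_mul x' i
  have he' : x * u⁻¹ = cs.simple i * x' := by
    rw [mul_inv_eq_iff_eq_mul, mul_assoc, he, cs.simple_mul_simple_cancel_left]
  have l5 := hx.length_mul (inv_mem hum)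
  rw [he', cs.length_inv] at l5
  rcases (by omega : cs.length u = 0 ∨ cs.length u = 1) with h | h
  · left
    rw [cs.length_eq_zero_iff.1 h, mul_one] at he
    rwa [← he]
  · right
    obtain ⟨j, hj⟩ := cs.length_eq_one_iff.1 h
    have hjm : cs.simple j ∈ parabolic cs J := hj ▸ hum
    refine ⟨j, hjm, ?_⟩
    have hlt : cs.length (cs.simple i * x * cs.simple j) < cs.length (cs.simple i * x) := by
      rw [← he, hj, cs.simple_mul_simple_cancel_right, ← hj, he]
      omega
    rw [length_mul_mul_lt_iff cs _ _ (cs.isReflection_simple j),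
      length_simple_mul_lt_iff cs i ((cs.isReflection_simple j).conj x)] at hlt
    rcases hlt with ⟨hlt, -⟩ | ⟨heq, -⟩
    · have := hx _ hjm
      omega
    · rw [← heq]
      simp

end Parabolic

/-! ### The twisted order on pairs -/

section Twisted

variable {cs} {J : Set B}

/-- The J-Bruhat order, in terms of pairs consisting of a minimal coset representative and an
element of `W_J`. -/
def PairLE (cs : CoxeterSystem M W) (J : Set B) (x y x' y' : W) : Prop :=
  ∃ u ∈ parabolic cs J, BruhatChain cs (x * u) x' ∧ BruhatChain cs y' (u⁻¹ * y)

lemma pairLE_of_le {x y x' y' : W} (hx : BruhatChain cs x x') (hy : BruhatChain cs y' y) :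
    PairLE cs J x y x' y' :=
  ⟨1, one_mem _, by simpa using hx, by simpa using hy⟩

/-- Multiplying the larger element of a Bruhat relation by `u ∈ W_J` on the right, while dividing
the smaller element of another one by `u`. -/
lemma exists_compensation {J : Set B} {u : W} (hu : u ∈ parabolic cs J) {x a y z : W}
    (hx : IsMinRep cs J x) (ha : BruhatChain cs a x) (hy : BruhatChain cs y z) :
    ∃ c ∈ parabolic cs J, BruhatChain cs (a * c) (x * u) ∧
      BruhatChain cs (u⁻¹ * y) (c⁻¹ * z) := by
  induction hn : cs.length u generalizing u with
  | zero =>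
    obtain rfl := cs.length_eq_zero_iff.1 hn
    exact ⟨1, one_mem _, by simpa using ha, by simpa using hy⟩
  | succ n ih =>
    obtain ⟨i, hi⟩ := cs.exists_rightDescent_of_ne_one (w := u) (by
      rintro rfl
      simp at hn)
    have him := mem_parabolic_of_length_mul_lt hu (cs.isReflection_simple i) hi
    have hl := cs.isRightDescent_iff.1 hi
    obtain ⟨c, hc, h1, h2⟩ := ih (mul_mem hu him) (by omega)
    have hlt := (hx.length_mul_simple_lt_iff hu him).2 hi
    rw [mul_assoc] at hlt
    have hup : cs.length (x * (u * cs.simple i)) <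
        cs.length (x * (u * cs.simple i) * cs.simple i) := by
      simpa [mul_assoc] using hlt
    rcases h2.simple_mul_le_or i with h | h
    · refine ⟨c, hc, h1.trans ?_, ?_⟩
      · simpa [mul_assoc] using BruhatChain.of_mul_simple hup
      · simpa [mul_assoc] using h
    · refine ⟨c * cs.simple i, mul_mem hc him, ?_, ?_⟩
      · simpa [mul_assoc] using h1.mul_simple_le_mul_simple hup
      · simpa [mul_assoc] using h

lemma PairLE.trans {x y x' y' x'' y'' : W} (hx' : IsMinRep cs J x') (h : PairLE cs J x y x' y')
    (h' : PairLE cs J x' y' x'' y'') : PairLE cs J x y x'' y'' := by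
  obtain ⟨u, hu, h1, h2⟩ := h
  obtain ⟨v, hv, h3, h4⟩ := h'
  obtain ⟨c, hc, h5, h6⟩ := exists_compensation hv hx' h1 h2
  refine ⟨u * c, mul_mem hu hc, ?_, ?_⟩
  · rw [← mul_assoc]
    exact h5.trans h3
  · rw [mul_inv_rev, mul_assoc]
    exact h4.trans h6

lemma PairLE.rank_le {x y x' y' : W} (hx : IsMinRep cs J x) (h : PairLE cs J x y x' y') :
    cs.length x + cs.length y' ≤ cs.length x' + cs.length y := by
  obtain ⟨u, hu, h1, h2⟩ := h
  have l1 := h1.length_le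
  have l2 := h2.length_le
  have l3 := cs.length_mul_le u⁻¹ y
  rw [hx.length_mul hu] at l1
  rw [cs.length_inv] at l3
  omega

lemma PairLE.mul_eq_mul {x y x' y' : W} (hx : IsMinRep cs J x) (h : PairLE cs J x y x' y')
    (hr : cs.length x' + cs.length y ≤ cs.length x + cs.length y') : x * y = x' * y' := by
  obtain ⟨u, hu, h1, h2⟩ := h
  have l0 := hx.length_mul hu
  have l1 := h1.length_le
  have l2 := h2.length_le
  have l3 := cs.length_mul_le u⁻¹ y
  rw [cs.length_inv] at l3
  rw [h2.eq_of_length_le (by omega), ← h1.eq_of_length_le (by omega)]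
  group

/-! #### Lifting for pairs

For a simple reflection `s = s_i`, the pair `(x, y)` is moved by `s` to `(s x, y)` if `s x` is again
a minimal representative, and to `(x, s_j y)` if `s x = x s_j`. -/

variable {x y x' y' : W} {i j k : B}

/-- Lifting when `s` moves the first component of both pairs. -/
lemma PairLE.lift_left_left (h : PairLE cs J x y x' y') (hx : IsMinRep cs J x)
    (hsx : IsMinRep cs J (cs.simple i * x)) (hl : cs.length x < cs.length (cs.simple i * x))
    (hl' : cs.length (cs.simple i * x') < cs.length x') :
    PairLE cs J (cs.simple i * x) y x' y' ∧ PairLE cs J x y (cs.simple i * x') y' := by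
  obtain ⟨u, hu, h1, h2⟩ := h
  have hlu : cs.length (x * u) < cs.length (cs.simple i * (x * u)) := by
    rw [← mul_assoc, hsx.length_mul hu, hx.length_mul hu]
    omega
  refine ⟨⟨u, hu, ?_, h2⟩, ⟨u, hu, h1.le_simple_mul hlu, h2⟩⟩
  rw [mul_assoc]
  exact h1.simple_mul_le hl'

/-- Lifting when `s` moves the first component of the lower pair and the second component of the
upper pair. -/
lemma PairLE.lift_left_right (h : PairLE cs J x y x' y') (hx : IsMinRep cs J x)
    (hx' : IsMinRep cs J x')
    (hsx : IsMinRep cs J (cs.simple i * x)) (hl : cs.length x < cs.length (cs.simple i * x))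
    (hk : cs.simple k ∈ parabolic cs J) (hsx' : cs.simple i * x' = x' * cs.simple k)
    (hl' : cs.length y' < cs.length (cs.simple k * y')) :
    PairLE cs J (cs.simple i * x) y x' y' ∧ PairLE cs J x y x' (cs.simple k * y') := by
  obtain ⟨u, hu, h1, h2⟩ := h
  have huk := mul_mem hu hk
  have e1 := hx.length_mul hu
  have e2 := hx.length_mul huk
  have e3 := hsx.length_mul hu
  have e4 := hsx.length_mul huk
  have e5 := hx'.length_mul hk
  have e6 := cs.length_simple k
  have hup' : cs.length x' < cs.length (x' * cs.simple k) := by omega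
  have hAu : cs.simple i * (x * u) = cs.simple i * x * u := (mul_assoc _ _ _).symm
  have hAuk : cs.simple i * (x * (u * cs.simple k)) = cs.simple i * x * (u * cs.simple k) :=
    (mul_assoc _ _ _).symm
  have hkk : x' * cs.simple k * cs.simple k = x' := cs.simple_mul_simple_cancel_right k
  have h3 : BruhatChain cs (cs.simple i * x * u) (x' * cs.simple k) := by
    rw [← hsx', ← hAu]
    exact h1.simple_mul_le_simple_mul (by rwa [hsx'])
  have hz := h2.simple_mul_le_or k
  have hinv : cs.simple k * (u⁻¹ * y) = (u * cs.simple k)⁻¹ * y := by simp [mul_assoc]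
  rcases cs.length_mul_simple u k with ek | ek
  · have h4 : BruhatChain cs (cs.simple i * x * u) x' := by
      rw [← hkk]
      exact h3.le_mul_simple (by rw [mul_assoc _ u]; omega)
    refine ⟨⟨u, hu, h4, h2⟩, ?_⟩
    rcases hz with hz | hz
    · exact ⟨u, hu, h1, hz⟩
    · refine ⟨u * cs.simple k, huk, ?_, by rwa [← hinv]⟩
      have h5 : BruhatChain cs (cs.simple i * (x * (u * cs.simple k))) (cs.simple i * x') := by
        rw [hsx', hAuk, ← mul_assoc]
        exact h4.mul_simple_le_mul_simple hup'
      have hasc : cs.length (x * (u * cs.simple k)) <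
          cs.length (cs.simple i * (x * (u * cs.simple k))) := by
        rw [hAuk]
        omega
      have h6 := ((BruhatChain.of_simple_mul hasc).trans h5).le_simple_mul hasc
      rwa [cs.simple_mul_simple_cancel_left] at h6
  · refine ⟨⟨u * cs.simple k, huk, ?_, ?_⟩, ?_⟩
    · have hlt : cs.length (cs.simple i * x * u * cs.simple k) <
          cs.length (cs.simple i * x * u) := by
        rw [mul_assoc _ u]
        omega
      have h4 := ((BruhatChain.mul_simple_self hlt).trans h3).le_mul_simple (i := k)
        (by rwa [cs.simple_mul_simple_cancel_right])
      rwa [hkk, mul_assoc _ u] at h4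
    · rw [← hinv]
      exact h2.le_simple_mul hl'
    · rcases hz with hz | hz
      · exact ⟨u, hu, h1, hz⟩
      · refine ⟨u * cs.simple k, huk, ?_, by rwa [← hinv]⟩
        rw [← mul_assoc]
        exact (BruhatChain.mul_simple_self (by rw [mul_assoc]; omega)).trans h1

lemma BruhatChain.inv_mul_le_inv_mul_simple_mul {u y : W} {j : B}
    (hu : cs.length (cs.simple j * u) < cs.length u)
    (hy : cs.length (cs.simple j * y) < cs.length y) :
    BruhatChain cs (u⁻¹ * y) (u⁻¹ * (cs.simple j * y)) := by
  have h := BruhatChain.mul_le_mul_simple_mul (cs := cs) (a := u⁻¹ * cs.simple j)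
    (b := cs.simple j * y) (i := j)
    (by
      rw [cs.simple_mul_simple_cancel_right, ← cs.length_inv, ← cs.length_inv u⁻¹]
      simpa using hu)
    (by rwa [cs.simple_mul_simple_cancel_left])
  simpa [mul_assoc] using h

/-- Lifting when `s` moves the second component of the lower pair and the first component of the
upper pair. -/
lemma PairLE.lift_right_left (h : PairLE cs J x y x' y') (hx : IsMinRep cs J x)
    (hj : cs.simple j ∈ parabolic cs J) (hsx : cs.simple i * x = x * cs.simple j)
    (hl : cs.length (cs.simple j * y) < cs.length y)
    (hl' : cs.length (cs.simple i * x') < cs.length x') :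
    PairLE cs J x (cs.simple j * y) x' y' ∧ PairLE cs J x y (cs.simple i * x') y' := by
  obtain ⟨u, hu, h1, h2⟩ := h
  have hju := mul_mem hj hu
  have e1 := hx.length_mul hu
  have e2 := hx.length_mul hju
  have hsu : cs.simple i * (x * u) = x * (cs.simple j * u) := by
    rw [← mul_assoc, hsx, mul_assoc]
  have hsju : cs.simple i * (x * (cs.simple j * u)) = x * u := by
    rw [← hsu, cs.simple_mul_simple_cancel_left]
  rcases cs.length_simple_mul u j with ej | ej
  · refine ⟨⟨cs.simple j * u, hju, ?_, by simpa [mul_assoc] using h2⟩,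
      ⟨u, hu, h1.le_simple_mul (by rw [hsu]; omega), h2⟩⟩
    rw [← hsu]
    exact h1.simple_mul_le hl'
  · have h5 := h2.trans
      (BruhatChain.inv_mul_le_inv_mul_simple_mul (u := u) (j := j) (by omega) hl)
    have hasc : cs.length (x * (cs.simple j * u)) <
        cs.length (cs.simple i * (x * (cs.simple j * u))) := by
      rw [hsju]
      omega
    have h6 := BruhatChain.of_simple_mul hasc
    rw [hsju] at h6
    exact ⟨⟨u, hu, h1, h5⟩, ⟨cs.simple j * u, hju, (h6.trans h1).le_simple_mul hasc,
      by simpa [mul_assoc] using h5⟩⟩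

/-- Lifting when `s` moves the second component of both pairs. -/
lemma PairLE.lift_right_right (h : PairLE cs J x y x' y') (hx : IsMinRep cs J x)
    (hx' : IsMinRep cs J x')
    (hj : cs.simple j ∈ parabolic cs J) (hsx : cs.simple i * x = x * cs.simple j)
    (hl : cs.length (cs.simple j * y) < cs.length y)
    (hk : cs.simple k ∈ parabolic cs J) (hsx' : cs.simple i * x' = x' * cs.simple k)
    (hl' : cs.length y' < cs.length (cs.simple k * y')) :
    PairLE cs J x (cs.simple j * y) x' y' ∧ PairLE cs J x y x' (cs.simple k * y') := by
  obtain ⟨u, hu, h1, h2⟩ := h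
  have hju := mul_mem hj hu
  have huk := mul_mem hu hk
  have hjuk := mul_mem hj huk
  have e1 := hx.length_mul hu
  have e2 := hx.length_mul hju
  have e3 := hx.length_mul huk
  have e4 := hx.length_mul hjuk
  have e5 := hx'.length_mul hk
  have e6 := cs.length_simple k
  have hs : ∀ v, cs.simple i * (x * v) = x * (cs.simple j * v) := fun v => by
    rw [← mul_assoc, hsx, mul_assoc]
  have hs' : ∀ v, cs.simple i * (x * (cs.simple j * v)) = x * v := fun v => by
    rw [← hs, cs.simple_mul_simple_cancel_left]
  have hup' : cs.length x' < cs.length (x' * cs.simple k) := by omega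
  have hkk : x' * cs.simple k * cs.simple k = x' := cs.simple_mul_simple_cancel_right k
  have hss : cs.simple i * (x' * cs.simple k) = x' := by
    rw [← hsx', cs.simple_mul_simple_cancel_left]
  have hinv : ∀ v : W, cs.simple k * (u⁻¹ * v) = (u * cs.simple k)⁻¹ * v := fun v => by
    simp [mul_assoc]
  have hinvj : ∀ v w : W, v⁻¹ * (cs.simple j * w) = (cs.simple j * v)⁻¹ * w := fun v w => by
    simp [mul_assoc]
  have hxuk : BruhatChain cs (x * (u * cs.simple k)) (x' * cs.simple k) := by
    rw [← mul_assoc]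
    exact h1.mul_simple_le_mul_simple hup'
  have hdown : cs.length (u * cs.simple k) < cs.length u →
      BruhatChain cs (x * (u * cs.simple k)) x' := by
    intro h
    rw [← mul_assoc]
    exact (BruhatChain.mul_simple_self (by rw [mul_assoc]; omega)).trans h1
  have a1 := cs.length_simple_mul u j
  have a2 := cs.length_mul_simple u k
  have a3 := cs.length_simple_mul (u * cs.simple k) j
  have a4 := cs.length_mul_simple (cs.simple j * u) k
  rw [mul_assoc] at a4
  rcases a1 with ej | ej
  · have h6 : BruhatChain cs (x * (cs.simple j * u)) (x' * cs.simple k) := by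
      rw [← hs, ← hsx']
      exact h1.simple_mul_le_simple_mul (by rwa [hsx'])
    constructor
    · rcases a4 with a4 | a4
      · refine ⟨cs.simple j * u, hju, ?_, by simpa [mul_assoc] using h2⟩
        rw [← hkk]
        exact h6.le_mul_simple (by rw [mul_assoc, mul_assoc]; omega)
      · refine ⟨cs.simple j * (u * cs.simple k), hjuk, ?_, ?_⟩
        · have hlt : cs.length (x * (cs.simple j * u) * cs.simple k) <
              cs.length (x * (cs.simple j * u)) := by
            rw [mul_assoc, mul_assoc]
            omega
          have h7 := ((BruhatChain.mul_simple_self hlt).trans h6).le_mul_simple (i := k)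
            (by rwa [cs.simple_mul_simple_cancel_right])
          rwa [hkk, mul_assoc, mul_assoc] at h7
        · simpa [mul_assoc] using h2.le_simple_mul hl'
    · rcases cs.length_simple_mul (u⁻¹ * y) k with hz | hz
      · refine ⟨u * cs.simple k, huk, ?_, ?_⟩
        · rcases a2 with a2 | a2
          · rcases a3 with a3 | a3
            · have h7 := hxuk.le_simple_mul (i := i) (by rw [hs]; omega)
              rwa [hss] at h7
            · exfalso
              have hc := length_mul_mul_lt_iff cs (cs.simple j) u (cs.isReflection_simple k)
              rw [length_simple_mul_lt_iff cs j ((cs.isReflection_simple k).conj u)] at hc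
              have hconj : u * cs.simple k * u⁻¹ = cs.simple j := by
                rcases hc.1 (by rw [mul_assoc]; omega) with ⟨hc, -⟩ | ⟨hc, -⟩
                · omega
                · exact hc
              have hkz : cs.simple k * (u⁻¹ * y) = u⁻¹ * (cs.simple j * y) := by
                rw [← hconj]
                group
              have h8 := BruhatChain.mul_le_mul_simple_mul (cs := cs) (a := u⁻¹)
                (b := cs.simple j * y) (i := j)
                (by
                  rw [← cs.length_inv, ← cs.length_inv (u⁻¹ * cs.simple j)]
                  simp [ej])
                (by rwa [cs.simple_mul_simple_cancel_left])
              have h9 := h8.length_le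
              rw [mul_assoc, cs.simple_mul_simple_cancel_left, ← hkz] at h9
              omega
          · exact hdown (by omega)
        · rw [← hinv]
          exact h2.simple_mul_le_simple_mul (by omega)
      · exact ⟨u, hu, h1, h2.simple_mul_le (by omega)⟩
  · have h5 := h2.trans
      (BruhatChain.inv_mul_le_inv_mul_simple_mul (u := u) (j := j) (by omega) hl)
    have hjx : BruhatChain cs (x * (cs.simple j * u)) x' := by
      have := BruhatChain.of_simple_mul (cs := cs) (x := x * (cs.simple j * u)) (i := i)
        (by rw [hs']; omega)
      rw [hs'] at this
      exact this.trans h1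
    refine ⟨⟨u, hu, h1, h5⟩, ?_⟩
    rcases h2.simple_mul_le_or k with hz | hz
    · exact ⟨u, hu, h1, hz⟩
    rcases a2 with a2 | a2
    · rcases h5.simple_mul_le_or k with hz' | hz'
      · exact ⟨cs.simple j * u, hju, hjx, by rwa [← hinvj]⟩
      · refine ⟨cs.simple j * (u * cs.simple k), hjuk, ?_, by simpa [mul_assoc] using hz'⟩
        have hasc : cs.length (x * (cs.simple j * (u * cs.simple k))) <
            cs.length (cs.simple i * (x * (cs.simple j * (u * cs.simple k)))) := by
          rw [hs']
          omega
        have h7 := BruhatChain.of_simple_mul hasc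
        rw [hs'] at h7
        have h8 := (h7.trans hxuk).le_simple_mul hasc
        rwa [hss] at h8
    · exact ⟨u * cs.simple k, huk, hdown (by omega), by rwa [← hinv]⟩

end Twisted

/-! ### Thinness of the twisted order -/

section TwistedThin

variable {cs} {J : Set B}

lemma twistedLE_iff_pairLE {v w : W} : twistedLE cs J v w ↔
    PairLE cs J (minRep cs J v) (parPart cs J v) (minRep cs J w) (parPart cs J w) := by
  simp only [twistedLE, PairLE, bruhatLE_iff_bruhatChain]

lemma twistedLE_mul_mul {x y x' y' : W} (hx : IsMinRep cs J x) (hy : y ∈ parabolic cs J)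
    (hx' : IsMinRep cs J x') (hy' : y' ∈ parabolic cs J) :
    twistedLE cs J (x * y) (x' * y') ↔ PairLE cs J x y x' y' := by
  rw [twistedLE_iff_pairLE, (hx.minRep_mul hy).1, (hx.minRep_mul hy).2, (hx'.minRep_mul hy').1,
    (hx'.minRep_mul hy').2]

lemma twistedLength_mul {x y : W} (hx : IsMinRep cs J x) (hy : y ∈ parabolic cs J) :
    twistedLength cs J (x * y) = cs.length x - cs.length y := by
  rw [twistedLength, (hx.minRep_mul hy).1, (hx.minRep_mul hy).2]

lemma twistedLE_refl (w : W) : twistedLE cs J w w :=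
  twistedLE_iff_pairLE.2 (pairLE_of_le .rfl .rfl)

lemma twistedLength_le_of_twistedLE {v w : W} (h : twistedLE cs J v w) :
    twistedLength cs J v ≤ twistedLength cs J w := by
  have := (twistedLE_iff_pairLE.1 h).rank_le (isMinRep_minRep v)
  unfold twistedLength
  omega

lemma eq_of_twistedLE {v w : W} (h : twistedLE cs J v w)
    (hr : twistedLength cs J w ≤ twistedLength cs J v) : v = w := by
  unfold twistedLength at hr
  have := (twistedLE_iff_pairLE.1 h).mul_eq_mul (isMinRep_minRep v) (by omega)
  rwa [minRep_mul_parPart, minRep_mul_parPart] at this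

/-- How left multiplication by a simple reflection acts on the decomposition `w = w^J w_J`. -/
lemma exists_simple_mul_decomposition (i : B) (w : W) :
    ∃ x y, IsMinRep cs J x ∧ y ∈ parabolic cs J ∧ w = x * y ∧
      ((IsMinRep cs J (cs.simple i * x) ∧ cs.simple i * w = cs.simple i * x * y) ∨
        ∃ j, cs.simple j ∈ parabolic cs J ∧ cs.simple i * x = x * cs.simple j ∧
          cs.simple i * w = x * (cs.simple j * y)) := by
  refine ⟨minRep cs J w, parPart cs J w, isMinRep_minRep w, parPart_mem w,
    (minRep_mul_parPart w).symm, ?_⟩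
  have he : cs.simple i * w = cs.simple i * minRep cs J w * parPart cs J w := by
    rw [mul_assoc, minRep_mul_parPart]
  refine ((isMinRep_minRep w).simple_mul i).imp (fun h => ⟨h, he⟩) ?_
  rintro ⟨j, hj, h⟩
  exact ⟨j, hj, h, by rw [he, h, mul_assoc]⟩

lemma liftingInvolution_twistedLE (i : B) :
    LiftingInvolution (twistedLE cs J) (twistedLength cs J) (fun x => cs.simple i * x) where
  trans _ y _ h h' := twistedLE_iff_pairLE.2
    ((twistedLE_iff_pairLE.1 h).trans (isMinRep_minRep y) (twistedLE_iff_pairLE.1 h'))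
  eq_of_rank _ _ := eq_of_twistedLE
  invol _ := cs.simple_mul_simple_cancel_left i
  rank w := by
    obtain ⟨x, y, hx, hy, rfl, ⟨hsx, he⟩ | ⟨j, hj, -, he⟩⟩ :=
      exists_simple_mul_decomposition (cs := cs) (J := J) i w
    · have := cs.length_simple_mul x i
      rw [he, twistedLength_mul hx hy, twistedLength_mul hsx hy]
      omega
    · have := cs.length_simple_mul y j
      rw [he, twistedLength_mul hx hy, twistedLength_mul hx (mul_mem hj hy)]
      omega
  le_self w h := by
    obtain ⟨x, y, hx, hy, rfl, ⟨hsx, he⟩ | ⟨j, hj, -, he⟩⟩ :=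
      exists_simple_mul_decomposition (cs := cs) (J := J) i w
    · rw [he, twistedLength_mul hx hy, twistedLength_mul hsx hy] at h
      rw [he, twistedLE_mul_mul hsx hy hx hy]
      exact pairLE_of_le (BruhatChain.simple_mul_self (by omega)) .rfl
    · rw [he, twistedLength_mul hx hy, twistedLength_mul hx (mul_mem hj hy)] at h
      rw [he, twistedLE_mul_mul hx (mul_mem hj hy) hx hy]
      exact pairLE_of_le .rfl (BruhatChain.of_simple_mul (by omega))
  lift v w h hv hw := by
    obtain ⟨x, y, hx, hy, rfl, hvs⟩ := exists_simple_mul_decomposition (cs := cs) (J := J) i v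
    obtain ⟨x', y', hx', hy', rfl, hws⟩ := exists_simple_mul_decomposition (cs := cs) (J := J) i w
    rw [twistedLE_mul_mul hx hy hx' hy'] at h
    rcases hvs with ⟨hsx, he⟩ | ⟨j, hj, hsx, he⟩ <;>
    rcases hws with ⟨hsx', he'⟩ | ⟨k, hk, hsx', he'⟩
    · rw [he, twistedLength_mul hx hy, twistedLength_mul hsx hy] at hv
      rw [he', twistedLength_mul hx' hy', twistedLength_mul hsx' hy'] at hw
      rw [he, he', twistedLE_mul_mul hsx hy hx' hy', twistedLE_mul_mul hx hy hsx' hy']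
      exact h.lift_left_left hx hsx (by omega) (by omega)
    · rw [he, twistedLength_mul hx hy, twistedLength_mul hsx hy] at hv
      rw [he', twistedLength_mul hx' hy', twistedLength_mul hx' (mul_mem hk hy')] at hw
      rw [he, he', twistedLE_mul_mul hsx hy hx' hy', twistedLE_mul_mul hx hy hx' (mul_mem hk hy')]
      exact h.lift_left_right hx hx' hsx (by omega) hk hsx' (by omega)
    · rw [he, twistedLength_mul hx hy, twistedLength_mul hx (mul_mem hj hy)] at hv
      rw [he', twistedLength_mul hx' hy', twistedLength_mul hsx' hy'] at hw
      rw [he, he', twistedLE_mul_mul hx (mul_mem hj hy) hx' hy', twistedLE_mul_mul hx hy hsx' hy']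
      exact h.lift_right_left hx hj hsx (by omega) (by omega)
    · rw [he, twistedLength_mul hx hy, twistedLength_mul hx (mul_mem hj hy)] at hv
      rw [he', twistedLength_mul hx' hy', twistedLength_mul hx' (mul_mem hk hy')] at hw
      rw [he, he', twistedLE_mul_mul hx (mul_mem hj hy) hx' hy',
        twistedLE_mul_mul hx hy hx' (mul_mem hk hy')]
      exact h.lift_right_right hx hx' hj hsx (by omega) hk hsx' (by omega)

lemma isMinRep_one : IsMinRep cs J 1 := fun u _ => by simp

lemma twistedLE_iff_of_mem_parabolic {z w : W} (hw : w ∈ parabolic cs J) :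
    twistedLE cs J z w ↔ z ∈ parabolic cs J ∧ BruhatChain cs w z := by
  have hw1 := isMinRep_one.minRep_mul hw
  rw [one_mul] at hw1
  rw [twistedLE_iff_pairLE, hw1.1, hw1.2]
  constructor
  · rintro ⟨u, hu, h1, h2⟩
    have hl := h1.length_le
    rw [(isMinRep_minRep z).length_mul hu, cs.length_one] at hl
    obtain rfl := cs.length_eq_zero_iff.1 (by omega : cs.length u = 0)
    have hz : parPart cs J z = z := by
      rw [parPart, cs.length_eq_zero_iff.1 (by omega : cs.length (minRep cs J z) = 0), inv_one,
        one_mul]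
    have hm := parPart_mem (cs := cs) (J := J) z
    rw [hz] at hm h2
    exact ⟨hm, by simpa using h2⟩
  · rintro ⟨hz, h⟩
    have hz1 := isMinRep_one.minRep_mul hz
    rw [one_mul] at hz1
    rw [hz1.1, hz1.2]
    exact pairLE_of_le .rfl h

lemma twistedLength_of_mem_parabolic {w : W} (hw : w ∈ parabolic cs J) :
    twistedLength cs J w = -cs.length w := by
  have := twistedLength_mul isMinRep_one hw
  simpa using this

lemma hasTwoMiddles_twistedLE {v w : W} (h : twistedLE cs J v w)
    (hr : twistedLength cs J w = twistedLength cs J v + 2) :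
    HasTwoMiddles (twistedLE cs J) (twistedLength cs J) v w := by
  induction hn : cs.length (minRep cs J w) generalizing v w with
  | zero =>
    have hw : w ∈ parabolic cs J := by
      rw [← minRep_mul_parPart (cs := cs) (J := J) w, cs.length_eq_zero_iff.1 hn, one_mul]
      exact parPart_mem w
    obtain ⟨hv, hwv⟩ := (twistedLE_iff_of_mem_parabolic hw).1 h
    rw [twistedLength_of_mem_parabolic hw, twistedLength_of_mem_parabolic hv] at hr
    obtain ⟨a, b, hab, hm⟩ := hasTwoMiddles_bruhatChain cs hwv (by omega)
    refine ⟨a, b, hab, fun z => ?_⟩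
    rw [← hm z, twistedLE_iff_of_mem_parabolic hw, twistedLength_of_mem_parabolic hv]
    beta_reduce
    constructor
    · rintro ⟨h1, ⟨hz, h2⟩, h3⟩
      rw [twistedLength_of_mem_parabolic hz] at h3
      exact ⟨h2, ((twistedLE_iff_of_mem_parabolic hz).1 h1).2, by omega⟩
    · rintro ⟨h1, h2, h3⟩
      have hz := h2.mem_parabolic hv
      rw [twistedLength_of_mem_parabolic hz]
      exact ⟨(twistedLE_iff_of_mem_parabolic hz).2 ⟨hv, h2⟩, ⟨hz, h1⟩, by omega⟩
  | succ n ih =>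
    obtain ⟨i, hi⟩ := cs.exists_leftDescent_of_ne_one (w := minRep cs J w) (by
      intro h1
      simp [h1] at hn)
    have hi' := cs.isLeftDescent_iff.1 hi
    have hmin := isMinRep_minRep (cs := cs) (J := J) w
    have hmem := parPart_mem (cs := cs) (J := J) w
    have hsmin : IsMinRep cs J (cs.simple i * minRep cs J w) := by
      refine (hmin.simple_mul i).resolve_right ?_
      rintro ⟨j, hj, he⟩
      have := hmin _ hj
      rw [← he] at this
      omega
    have hsw : cs.simple i * w = cs.simple i * minRep cs J w * parPart cs J w := by
      rw [mul_assoc, minRep_mul_parPart]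
    have hw : twistedLength cs J (cs.simple i * w) < twistedLength cs J w := by
      rw [hsw, twistedLength_mul hsmin hmem, twistedLength]
      omega
    have hL := liftingInvolution_twistedLE (cs := cs) (J := J) i
    have hru := hL.rank v
    have hrw := hL.rank w
    by_cases hv : twistedLength cs J (cs.simple i * v) < twistedLength cs J v
    · refine hL.hasTwoMiddles_of_descent h hr hw hv
        (ih (hL.le_of_descents h hw hv) (by omega) ?_)
      rw [hsw, (hsmin.minRep_mul hmem).1]
      omega
    · exact hL.hasTwoMiddles_of_ascent h hr hw (by omega)

end TwistedThin

/-- Let `J ⊆ I` and `v ≤^J w` with `ℓ^J(w) - ℓ^J(v) = 2`. Then the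
interval `{z : v ≤^J z ≤^J w}` of `(W, ≤^J)` has exactly `4` elements; that is,
`(W, ≤^J)` is thin. -/
theorem twisted_thin (J : Set B) (v w : W) (hvw : twistedLE cs J v w)
    (hlen : twistedLength cs J w - twistedLength cs J v = 2) :
    {z : W | twistedLE cs J v z ∧ twistedLE cs J z w}.ncard = 4 := by
  have hr : twistedLength cs J w = twistedLength cs J v + 2 := by omega
  exact (hasTwoMiddles_twistedLE hvw hr).ncard_eq_four twistedLE_refl
    (fun _ _ => twistedLength_le_of_twistedLE) (fun _ _ => eq_of_twistedLE) hvw hr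

end TwistedTP
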